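/- Let N ≥ 2 and let λ_1, …, λ_ℓ be pairwise distinct complex numbers with λ_j ∉ {i/2, −i/2} for all j, satisfying the Bethe ansatz equations ((λ_k + i/2)/(λ_k − i/2))^N = ∏_{j ≠ k} (λ_k − λ_j + i)/(λ_k − λ_j − i) for k = 1, …, ℓ. Then the Bethe vector Ψ_N(λ_1, …, λ_ℓ) = B_N(λ_1)···B_N(λ_ℓ)|0⟩_N satisfies 𝓗_N Ψ_N(λ_1, …, λ_ℓ) = E·Ψ_N(λ_1, …, λ_ℓ) with E = −(J/2)·∑_{j=1}^{ℓ} 1/(λ_j² + 1/4). -/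

import Mathlib

open scoped TensorProduct

noncomputable section

namespace Heisenberg

/-- The state space `𝔥_N = (ℂ²)^⊗N`. -/
abbrev QState (N : ℕ) : Type := ⨂[ℂ] _i : Fin N, (Fin 2 → ℂ)

/-- The Pauli matrix `σ^x`. -/
def pauliX : Matrix (Fin 2) (Fin 2) ℂ := !![0, 1; 1, 0]

/-- The Pauli matrix `σ^y`. -/
def pauliY : Matrix (Fin 2) (Fin 2) ℂ := !![0, -Complex.I; Complex.I, 0]

/-- The Pauli matrix `σ^z`. -/
def pauliZ : Matrix (Fin 2) (Fin 2) ℂ := !![1, 0; 0, -1]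

/-- `σ^+ = σ^x + iσ^y`. -/
def pauliPlus : Matrix (Fin 2) (Fin 2) ℂ := pauliX + Complex.I • pauliY

/-- `σ^- = σ^x - iσ^y`. -/
def pauliMinus : Matrix (Fin 2) (Fin 2) ℂ := pauliX - Complex.I • pauliY

/-- `σ_k^a`: the operator acting as the 2×2 matrix `M` on the `k`-th tensor factor
and as the identity elsewhere. -/
def siteOp (N : ℕ) (k : Fin N) (M : Matrix (Fin 2) (Fin 2) ℂ) :
    Module.End ℂ (QState N) :=
  PiTensorProduct.map (fun i => if i = k then Matrix.toLin' M else LinearMap.id)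

/-- The Heisenberg Hamiltonian
`𝓗_N = (J/4)·∑_k (σ_k^x σ_{k+1}^x + σ_k^y σ_{k+1}^y + σ_k^z σ_{k+1}^z − Id)`
with periodic boundary conditions (the successor of `k` in `Fin N` is `finRotate N k`). -/
def ham (N : ℕ) (J : ℝ) : Module.End ℂ (QState N) :=
  ((J : ℂ) / 4) • ∑ k : Fin N,
    (siteOp N k pauliX * siteOp N (finRotate N k) pauliX +
     siteOp N k pauliY * siteOp N (finRotate N k) pauliY +
     siteOp N k pauliZ * siteOp N (finRotate N k) pauliZ - 1)

/-- The total spin operator `S^a = (1/2)·∑_k σ_k^a`. -/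
def spin (N : ℕ) (a : Matrix (Fin 2) (Fin 2) ℂ) : Module.End ℂ (QState N) :=
  ((1 : ℂ) / 2) • ∑ k : Fin N, siteOp N k a

/-- The Lax operator `L_k(λ)`, a 2×2 matrix with entries in `End(𝔥_N)`. -/
def lax (N : ℕ) (k : Fin N) (lam : ℂ) : Matrix (Fin 2) (Fin 2) (Module.End ℂ (QState N)) :=
  !![lam • (1 : Module.End ℂ (QState N)) + (Complex.I / 2) • siteOp N k pauliZ,
       (Complex.I / 2) • siteOp N k pauliMinus;
     (Complex.I / 2) • siteOp N k pauliPlus,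
       lam • (1 : Module.End ℂ (QState N)) - (Complex.I / 2) • siteOp N k pauliZ]

/-- The transfer matrix `T_N(λ) = L_N(λ)·L_{N−1}(λ)···L_1(λ)`. -/
def transfer (N : ℕ) (lam : ℂ) : Matrix (Fin 2) (Fin 2) (Module.End ℂ (QState N)) :=
  ((List.ofFn (fun k : Fin N => lax N k lam)).reverse).prod

/-- The creation operator `B_N(λ)`, the top-right entry of the transfer matrix. -/
def Bop (N : ℕ) (lam : ℂ) : Module.End ℂ (QState N) := transfer N lam 0 1

/-- The reference state `|0⟩_N = v₊ ⊗ ⋯ ⊗ v₊` with all spins up. -/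
def vacuum (N : ℕ) : QState N :=
  PiTensorProduct.tprod ℂ (fun _ : Fin N => ![(1 : ℂ), 0])

/-- The Bethe vector `Ψ_N(λ_1, …, λ_ℓ) = B_N(λ_1)···B_N(λ_ℓ)|0⟩_N`. -/
def betheVec (N : ℕ) {ℓ : ℕ} (lam : Fin ℓ → ℂ) : QState N :=
  ((List.ofFn (fun j : Fin ℓ => Bop N (lam j))).prod) (vacuum N)

section SiteAlgebra

variable {N : ℕ}

lemma siteOp_eq_mapMultilinear (k : Fin N) (M : Matrix (Fin 2) (Fin 2) ℂ) :
    siteOp N k M = PiTensorProduct.mapMultilinear ℂ (fun _ : Fin N => Fin 2 → ℂ) (fun _ => Fin 2 → ℂ)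
      (Function.update (fun _ => LinearMap.id) k (Matrix.toLin' M)) := by
  rw [siteOp, PiTensorProduct.mapMultilinear_apply]
  congr 1
  ext1 i
  by_cases h : i = k
  · subst h; simp
  · simp [h]

lemma siteOp_add (k : Fin N) (M M' : Matrix (Fin 2) (Fin 2) ℂ) :
    siteOp N k (M + M') = siteOp N k M + siteOp N k M' := by
  simp only [siteOp_eq_mapMultilinear, map_add, MultilinearMap.map_update_add]

lemma siteOp_smul (k : Fin N) (c : ℂ) (M : Matrix (Fin 2) (Fin 2) ℂ) :
    siteOp N k (c • M) = c • siteOp N k M := by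
  simp only [siteOp_eq_mapMultilinear, map_smul, MultilinearMap.map_update_smul]

lemma siteOp_one (k : Fin N) : siteOp N k 1 = 1 := by
  rw [siteOp, ← PiTensorProduct.map_one]
  congr 1
  ext1 i
  split_ifs
  · exact Matrix.toLin'_one
  · rfl

lemma siteOp_mul (k : Fin N) (M M' : Matrix (Fin 2) (Fin 2) ℂ) :
    siteOp N k M * siteOp N k M' = siteOp N k (M * M') := by
  rw [siteOp, siteOp, siteOp, ← PiTensorProduct.map_mul]
  congr 1
  ext1 i
  split_ifs
  · exact (Matrix.toLin'_mul M M').symm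
  · rfl

lemma siteOp_commute {k l : Fin N} (h : k ≠ l) (M M' : Matrix (Fin 2) (Fin 2) ℂ) :
    Commute (siteOp N k M) (siteOp N l M') := by
  rw [Commute, SemiconjBy, siteOp, siteOp, ← PiTensorProduct.map_mul, ← PiTensorProduct.map_mul]
  congr 1
  ext1 i
  by_cases hk : i = k
  · subst hk; simp [h]; rfl
  · simp [hk]; rfl

/-- The operator acting as the matrix unit `E_{ab}` on the `k`-th tensor factor. -/
def unitOp (k : Fin N) (a b : Fin 2) : Module.End ℂ (QState N) :=
  siteOp N k (Matrix.single a b 1)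

lemma siteOp_eq_unitOp (k : Fin N) (M : Matrix (Fin 2) (Fin 2) ℂ) :
    siteOp N k M = M 0 0 • unitOp k 0 0 + M 0 1 • unitOp k 0 1 +
      M 1 0 • unitOp k 1 0 + M 1 1 • unitOp k 1 1 := by
  simp only [unitOp, ← siteOp_smul, ← siteOp_add]
  congr 1
  ext i j
  fin_cases i <;> fin_cases j <;> simp

lemma unitOp_mul (k : Fin N) (a b c d : Fin 2) :
    unitOp k a b * unitOp k c d = if b = c then unitOp k a d else 0 := by
  rw [unitOp, unitOp, siteOp_mul]
  split_ifs with h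
  · subst h; simp [unitOp]
  · rw [Matrix.single_mul_single_of_ne _ _ _ _ h]
    simpa using siteOp_smul k 0 (0 : Matrix (Fin 2) (Fin 2) ℂ)

lemma unitOp_commute {k l : Fin N} (h : k ≠ l) (a b c d : Fin 2) :
    Commute (unitOp k a b) (unitOp l c d) :=
  siteOp_commute h _ _

lemma unitOp_add_eq_one (k : Fin N) : unitOp k 0 0 + unitOp k 1 1 = 1 := by
  rw [← siteOp_one k, siteOp_eq_unitOp k 1]
  simp

lemma unitOp_vacuum (k : Fin N) (a b : Fin 2) (h : b = 1 ∨ a = 0) :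
    unitOp k a b (vacuum N) = if b = 0 then vacuum N else 0 := by
  have key : unitOp k a b (vacuum N) = PiTensorProduct.tprod ℂ (Function.update
      (fun _ : Fin N => ![(1 : ℂ), 0]) k ((Matrix.single a b (1 : ℂ)).mulVec ![1, 0])) := by
    rw [unitOp, siteOp, vacuum, PiTensorProduct.map_tprod]
    congr 1
    ext1 i
    by_cases hi : i = k
    · subst hi; simp
    · simp [hi]
  rw [key]
  fin_cases b
  · obtain rfl : a = 0 := by simpa using h
    have : (Matrix.single (0 : Fin 2) (0 : Fin 2) (1 : ℂ)).mulVec ![1, 0] = ![1, 0] := by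
      ext i; fin_cases i <;> simp [Matrix.mulVec, dotProduct]
    simp only [Fin.zero_eta, this]
    rw [Function.update_eq_self k (fun _ : Fin N => ![(1 : ℂ), 0])]
    simp [vacuum]
  · have : (Matrix.single a (1 : Fin 2) (1 : ℂ)).mulVec ![1, 0] = 0 := by
      ext i; simp [Matrix.mulVec, dotProduct, Matrix.single_apply]
    simp only [Fin.mk_one, this]
    rw [MultilinearMap.map_update_zero]
    simp

end SiteAlgebra

section SpinSystem

variable {R : Type*} [Ring R] [Algebra ℂ R] {ι : Type*}

/-- The exchange relation `R(u) (X ⊗ 1) (1 ⊗ Y) = (1 ⊗ Y) (X ⊗ 1) R(u)` for the rational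
`R`-matrix `R(u) = u + iP`, written in components. -/
def Exchange (u : ℂ) (X Y : Matrix (Fin 2) (Fin 2) R) : Prop :=
  ∀ i j k l, u • (X i j * Y k l) + Complex.I • (X k j * Y i l) =
    u • (Y k l * X i j) + Complex.I • (Y k j * X i l)

lemma Exchange.one (u : ℂ) : Exchange u (1 : Matrix (Fin 2) (Fin 2) R) 1 := by
  intro i j k l
  fin_cases i <;> fin_cases j <;> fin_cases k <;> fin_cases l <;> simp

lemma Exchange.mul {u : ℂ} {X X' Y Y' : Matrix (Fin 2) (Fin 2) R} (hX : Exchange u X X')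
    (hY : Exchange u Y Y') (h : ∀ a b c d, Commute (Y a b) (X' c d))
    (h' : ∀ a b c d, Commute (Y' a b) (X c d)) : Exchange u (X * Y) (X' * Y') := by
  intro i j k l
  have hl (i j k l p q : Fin 2) :
      X i p * Y p j * (X' k q * Y' q l) = X i p * X' k q * (Y p j * Y' q l) :=
    (h p j k q).mul_mul_mul_comm _ _
  have hr (i j k l p q : Fin 2) :
      X' k q * Y' q l * (X i p * Y p j) = X' k q * X i p * (Y' q l * Y p j) :=
    (h' q l i p).mul_mul_mul_comm _ _
  calc _ = ∑ p, ∑ q, (u • (X i p * X' k q) + Complex.I • (X k p * X' i q)) *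
        (Y p j * Y' q l) := by
        simp only [Matrix.mul_apply, Finset.sum_mul_sum, hl, Finset.smul_sum, add_mul,
          smul_mul_assoc, Finset.sum_add_distrib]
    _ = ∑ p, ∑ q, X' k q * X i p * (u • (Y p j * Y' q l) + Complex.I • (Y q j * Y' p l)) := by
        simp only [hX i _ k _, add_mul, mul_add, smul_mul_assoc, mul_smul_comm,
          Finset.sum_add_distrib]
        congr 1
        exact Finset.sum_comm
    _ = _ := by
        simp only [hY _ j _ l, Matrix.mul_apply, Finset.sum_mul_sum, hr, Finset.smul_sum, mul_add,
          mul_smul_comm, Finset.sum_add_distrib]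
        congr 1 <;> exact Finset.sum_comm

/-- Operators `e k a b` behaving like the matrix units `E_{ab}` at pairwise commuting sites `k`. -/
structure IsSpinSystem (e : ι → Fin 2 → Fin 2 → R) : Prop where
  mul : ∀ k a b c d, e k a b * e k c d = if b = c then e k a d else 0
  commute : ∀ k l, k ≠ l → ∀ a b c d, Commute (e k a b) (e l c d)
  add_eq_one : ∀ k, e k 0 0 + e k 1 1 = 1

variable (e : ι → Fin 2 → Fin 2 → R)

/-- The Lax matrix at the site `k` and the spectral parameter `ν + i/2`. -/
def siteLax (k : ι) (ν : ℂ) : Matrix (Fin 2) (Fin 2) R :=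
  Matrix.of (fun a b => Complex.I • e k b a) + ν • 1

lemma siteLax_apply (k : ι) (ν : ℂ) (a b : Fin 2) :
    siteLax e k ν a b = Complex.I • e k b a + (if a = b then ν else 0) • (1 : R) := by
  simp only [siteLax, Matrix.add_apply, Matrix.of_apply, Matrix.smul_apply, Matrix.one_apply]
  split_ifs <;> simp

lemma siteLax_eq_add (k : ι) (ν : ℂ) : siteLax e k ν = siteLax e k 0 + ν • 1 := by
  simp [siteLax]

/-- The ordered product of Lax matrices along the sites `f 0, …, f (n - 1)`, the last site
coming leftmost. -/
def monodromy (ν : ℂ) {n : ℕ} (f : Fin n → ι) : Matrix (Fin 2) (Fin 2) R :=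
  ((List.ofFn fun k => siteLax e (f k) ν).reverse).prod

lemma monodromy_zero (ν : ℂ) (f : Fin 0 → ι) : monodromy e ν f = 1 := by
  simp [monodromy]

lemma monodromy_succ (ν : ℂ) {n : ℕ} (f : Fin (n + 1) → ι) :
    monodromy e ν f = siteLax e (f (Fin.last n)) ν * monodromy e ν (f ∘ Fin.castSucc) := by
  simp [monodromy, -List.ofFn_succ, List.ofFn_succ_last]

lemma monodromy_succ' (ν : ℂ) {n : ℕ} (f : Fin (n + 1) → ι) :
    monodromy e ν f = monodromy e ν (f ∘ Fin.succ) * siteLax e (f 0) ν := by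
  simp [monodromy, List.ofFn_succ]

variable {e}

lemma commute_siteLax {x : R} {k : ι} (h : ∀ a b, Commute x (e k a b)) (ν : ℂ) (a b : Fin 2) :
    Commute x (siteLax e k ν a b) := by
  rw [siteLax_apply]
  exact ((h b a).smul_right _).add_right ((Commute.one_right x).smul_right _)

lemma commute_monodromy {x : R} {n : ℕ} {f : Fin n → ι}
    (h : ∀ m a b, Commute x (e (f m) a b)) (ν : ℂ) (a b : Fin 2) :
    Commute x (monodromy e ν f a b) := by
  induction n generalizing a b with
  | zero =>
    rw [monodromy_zero, Matrix.one_apply]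
    split_ifs
    · exact Commute.one_right x
    · exact Commute.zero_right x
  | succ n ih =>
    rw [monodromy_succ, Matrix.mul_apply]
    exact Commute.sum_right _ _ _ fun c _ =>
      (commute_siteLax (h _) ν a c).mul_right (ih (fun m => h m.castSucc) c b)

variable (he : IsSpinSystem e)
include he

lemma IsSpinSystem.exchange_siteLax (k : ι) (ν ν' : ℂ) :
    Exchange (ν - ν') (siteLax e k ν) (siteLax e k ν') := by
  intro i j k l
  simp only [siteLax_apply, mul_add, add_mul, smul_mul_assoc, mul_smul_comm, he.mul, mul_one,
    one_mul]
  fin_cases i <;> fin_cases j <;> fin_cases k <;> fin_cases l <;> simp <;> module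

lemma IsSpinSystem.commute_siteLax_monodromy {k : ι} {n : ℕ} {f : Fin n → ι}
    (h : ∀ m, k ≠ f m) (ν ν' : ℂ) (a b c d : Fin 2) :
    Commute (siteLax e k ν a b) (monodromy e ν' f c d) :=
  commute_monodromy (fun m p q =>
    (commute_siteLax (fun r s => he.commute (f m) k (h m).symm p q r s) ν a b).symm) ν' c d

lemma IsSpinSystem.exchange_monodromy (ν ν' : ℂ) {n : ℕ} {f : Fin n → ι}
    (hf : Function.Injective f) : Exchange (ν - ν') (monodromy e ν f) (monodromy e ν' f) := by
  induction n with
  | zero => simpa only [monodromy_zero] using Exchange.one _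
  | succ n ih =>
    have h (m : Fin n) : f (Fin.last n) ≠ (f ∘ Fin.castSucc) m :=
      fun h => (Fin.castSucc_lt_last m).ne (hf h).symm
    simp only [monodromy_succ]
    exact (he.exchange_siteLax _ ν ν').mul (ih (hf.comp (Fin.castSucc_injective n)))
      (fun a b c d => (he.commute_siteLax_monodromy h _ _ c d a b).symm)
      (fun a b c d => (he.commute_siteLax_monodromy h _ _ c d a b).symm)

omit he [Algebra ℂ R] in
lemma mul_smul_of_commute {n : Type*} [Fintype n] {r : R} {M : Matrix n n R}
    (h : ∀ a b, Commute r (M a b)) (M' : Matrix n n R) : M * (r • M') = r • (M * M') := by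
  ext a b
  simp only [Matrix.mul_apply, Matrix.smul_apply, smul_eq_mul, Finset.mul_sum]
  exact Finset.sum_congr rfl fun c _ => ((h a c).left_comm _).symm

omit he [Algebra ℂ R] in
lemma trace_mul_comm_of_commute {n : Type*} [Fintype n] {M M' : Matrix n n R}
    (h : ∀ a b c d, Commute (M a b) (M' c d)) : (M * M').trace = (M' * M).trace := by
  simp only [Matrix.trace, Matrix.diag, Matrix.mul_apply]
  rw [Finset.sum_comm]
  exact Finset.sum_congr rfl fun a _ => Finset.sum_congr rfl fun b _ => h _ _ _ _

variable (e) in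
/-- The permutation operator of the sites `k` and `l`. -/
def sitePerm (k l : ι) : R := ∑ a, ∑ b, e k a b * e l b a

omit [Algebra ℂ R] in
lemma IsSpinSystem.commute_sitePerm {k l m : ι} (hk : k ≠ m) (hl : l ≠ m) (a b : Fin 2) :
    Commute (sitePerm e k l) (e m a b) :=
  Commute.sum_left _ _ _ fun _ _ => Commute.sum_left _ _ _ fun _ _ =>
    (he.commute k m hk _ _ _ _).mul_left (he.commute l m hl _ _ _ _)

lemma IsSpinSystem.sitePerm_smul {k l : ι} (h : k ≠ l) :
    sitePerm e k l • (siteLax e l 0 * siteLax e k 0) = Complex.I • siteLax e l 0 := by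
  have key (a b c d p : Fin 2) : e k c d * e l d c * (e l p a * e k b p) =
      (if d = b then if c = p then e k c c * e l d a else 0 else 0) := by
    rw [(he.commute l k h.symm _ _ _ _).eq, (he.commute k l h _ _ _ _).symm.mul_mul_mul_comm,
      he.mul, he.mul]
    split_ifs with h1 h2
    · subst h2; rfl
    all_goals simp
  ext a b
  simp only [Matrix.smul_apply, Matrix.mul_apply, siteLax_apply, ite_self, zero_smul, add_zero,
    smul_eq_mul, sitePerm, Finset.sum_mul, Finset.mul_sum, smul_mul_assoc, mul_smul_comm, key,
    smul_smul, Complex.I_mul_I]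
  simp only [Finset.sum_ite_eq', Finset.mem_univ, if_true, ← Finset.smul_sum]
  simp [Fin.sum_univ_two, ← add_mul, he.add_eq_one]

variable (e) in
/-- The derivative of `monodromy e ν f` with respect to `ν` at `ν = 0`. -/
def monodromyDeriv : {n : ℕ} → (Fin n → ι) → Matrix (Fin 2) (Fin 2) R
  | 0, _ => 0
  | n + 1, f => siteLax e (f (Fin.last n)) 0 * monodromyDeriv (f ∘ Fin.castSucc) +
      monodromy e 0 (f ∘ Fin.castSucc)

omit he in
lemma hasDerivAt_monodromy {n : ℕ} (f : Fin n → ι) (φ : Matrix (Fin 2) (Fin 2) R →ₗ[ℂ] ℂ) :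
    HasDerivAt (fun ν => φ (monodromy e ν f)) (φ (monodromyDeriv e f)) 0 := by
  induction n generalizing φ with
  | zero => simpa [monodromy_zero, monodromyDeriv] using hasDerivAt_const (0 : ℂ) (φ 1)
  | succ n ih =>
    have h1 := ih (f ∘ Fin.castSucc)
      (φ ∘ₗ LinearMap.mulLeft ℂ (siteLax e (f (Fin.last n)) 0))
    have h2 := (hasDerivAt_id (0 : ℂ)).fun_mul (ih (f ∘ Fin.castSucc) φ)
    refine ((h1.fun_add h2).congr_deriv ?_).congr_of_eventuallyEq (.of_forall fun ν => ?_)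
    · simp [monodromyDeriv]
    · simp only [monodromy_succ, siteLax_eq_add e _ ν, add_mul, map_add, smul_mul_assoc, one_mul,
        map_smul]
      simp

lemma IsSpinSystem.sum_sitePerm_smul_monodromy {n : ℕ} {f : Fin (n + 1) → ι}
    (hf : Function.Injective f) :
    (∑ k : Fin n, sitePerm e (f k.castSucc) (f k.succ)) • monodromy e 0 f =
      Complex.I • (siteLax e (f (Fin.last n)) 0 * monodromyDeriv e (f ∘ Fin.castSucc)) := by
  induction n with
  | zero => simp [monodromyDeriv]
  | succ n ih =>
    have hne (m : Fin (n + 1)) : f m.castSucc ≠ f (Fin.last (n + 1)) :=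
      fun h => (Fin.castSucc_lt_last m).ne (hf h)
    have ih := ih (f := f ∘ Fin.castSucc) (hf.comp (Fin.castSucc_injective _))
    rw [Fin.sum_univ_castSucc, add_smul, monodromy_succ]
    have hcomm (a b : Fin 2) : Commute
        (∑ k : Fin n, sitePerm e (f k.castSucc.castSucc) (f k.castSucc.succ))
        (siteLax e (f (Fin.last (n + 1))) 0 a b) :=
      Commute.sum_left _ _ _ fun k _ => commute_siteLax
        (he.commute_sitePerm (hne _) (by rw [Fin.succ_castSucc]; exact hne k.succ)) _ _ _
    rw [← mul_smul_of_commute hcomm]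
    simp only [Function.comp_apply, ← Fin.succ_castSucc] at ih ⊢
    rw [ih, monodromy_succ, ← mul_assoc, ← smul_mul_assoc (sitePerm e _ _)]
    simp only [Function.comp_apply, Fin.succ_last, Nat.succ_eq_add_one]
    rw [he.sitePerm_smul (hne _), monodromyDeriv]
    simp [mul_add, smul_add]

/-- The trace identity: the sum of the permutations of neighbouring sites is the logarithmic
derivative of the transfer matrix. -/
lemma IsSpinSystem.sum_sitePerm_mul_trace {n : ℕ} {f : Fin (n + 2) → ι}
    (hf : Function.Injective f) :
    (∑ k, sitePerm e (f k) (f (finRotate _ k))) * (monodromy e 0 f).trace =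
      Complex.I • (monodromyDeriv e f).trace := by
  have hbdry : sitePerm e (f (Fin.last (n + 1))) (f 0) * (monodromy e 0 f).trace =
      Complex.I • (monodromy e 0 (f ∘ Fin.castSucc)).trace := by
    have h0 (m : Fin (n + 1)) : f 0 ≠ f m.succ := fun h => (Fin.succ_ne_zero m) (hf h).symm
    have hc (a b c d : Fin 2) :
        Commute (monodromy e 0 ((f ∘ Fin.castSucc) ∘ Fin.succ) a b)
          (siteLax e ((f ∘ Fin.castSucc) 0) 0 c d) :=
      (he.commute_siteLax_monodromy (fun m h =>
        Fin.succ_ne_zero m (Fin.castSucc_injective _ (hf h)).symm) _ _ _ _ _ _).symm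
    have hc' (a b c d : Fin 2) :
        Commute (monodromy e 0 (f ∘ Fin.succ) a b) (siteLax e (f 0) 0 c d) :=
      (he.commute_siteLax_monodromy h0 _ _ _ _ _ _).symm
    rw [monodromy_succ', trace_mul_comm_of_commute hc', monodromy_succ, ← mul_assoc,
      ← smul_eq_mul, ← Matrix.trace_smul, ← smul_mul_assoc, monodromy_succ' e 0 (f ∘ Fin.castSucc),
      trace_mul_comm_of_commute hc]
    have hp := he.sitePerm_smul (h0 (Fin.last n)).symm
    simp only [Function.comp_apply, Fin.succ_last, Nat.succ_eq_add_one] at hp ⊢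
    rw [hp, smul_mul_assoc, Matrix.trace_smul]
    rfl
  rw [Fin.sum_univ_castSucc, add_mul, finRotate_last, hbdry, ← smul_eq_mul, ← Matrix.trace_smul]
  have hrot (k : Fin (n + 1)) : finRotate (n + 2) k.castSucc = k.succ := by
    simp
  simp only [hrot]
  rw [he.sum_sitePerm_smul_monodromy hf, Matrix.trace_smul, ← smul_add, ← Matrix.trace_add]
  rfl

end SpinSystem

section BetheAnsatz

variable {V : Type*} [AddCommGroup V] [Module ℂ V] {κ : Type*} [DecidableEq κ]

/-- The off-shell action of a diagonal entry `X` of the monodromy matrix on the vectors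
`Ψ S = ∏_{k ∈ S} B(x_k) v`. -/
lemma offShell_action {X B : ℂ → Module.End ℂ V} {c : ℂ}
    (hX : ∀ μ ν, μ ≠ ν → X μ * B ν =
      (1 - c / (μ - ν)) • (B ν * X μ) + (c / (μ - ν)) • (B μ * X ν))
    (hB : ∀ μ ν, Commute (B μ) (B ν)) {a : ℂ → ℂ} {x : κ → ℂ} (hx : Function.Injective x)
    {Ψ : Finset κ → V} (hvac : ∀ μ, X μ (Ψ ∅) = a μ • Ψ ∅)
    (hΨ : ∀ m S, m ∉ S → Ψ (insert m S) = B (x m) (Ψ S)) (S : Finset κ) (μ : ℂ)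
    (hμ : ∀ k ∈ S, μ ≠ x k) :
    X μ (Ψ S) = (a μ * ∏ j ∈ S, (1 - c / (μ - x j))) • Ψ S +
      ∑ k ∈ S, (c / (μ - x k) * (a (x k) * ∏ j ∈ S.erase k, (1 - c / (x k - x j)))) •
        B μ (Ψ (S.erase k)) := by
  induction S using Finset.induction_on generalizing μ with
  | empty => simp [hvac]
  | insert m S hm ih =>
    have hμm : μ ≠ x m := hμ m (Finset.mem_insert_self _ _)
    have hXB (w : V) : X μ (B (x m) w) = (1 - c / (μ - x m)) • B (x m) (X μ w) +
        (c / (μ - x m)) • B μ (X (x m) w) := by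
      simpa using LinearMap.congr_fun (hX μ (x m) hμm) w
    have hne : ∀ k ∈ S, x m ≠ x k := fun k hk h => hm (by rwa [hx h])
    have hsum : ∀ k ∈ S, (c / (μ - x k) * (a (x k) *
        ∏ j ∈ (insert m S).erase k, (1 - c / (x k - x j)))) • B μ (Ψ ((insert m S).erase k)) =
        (1 - c / (μ - x m)) • (c / (μ - x k) * (a (x k) *
          ∏ j ∈ S.erase k, (1 - c / (x k - x j)))) • B (x m) (B μ (Ψ (S.erase k))) +
        (c / (μ - x m)) • (c / (x m - x k) * (a (x k) *
          ∏ j ∈ S.erase k, (1 - c / (x k - x j)))) • B μ (B (x m) (Ψ (S.erase k))) := by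
      intro k hk
      have hmk : m ∉ S.erase k := fun h => hm (Finset.mem_of_mem_erase h)
      have h1 : μ - x m ≠ 0 := sub_ne_zero.2 hμm
      have h2 : x m - x k ≠ 0 := sub_ne_zero.2 (hne k hk)
      have h2' : x k - x m ≠ 0 := sub_ne_zero.2 (hne k hk).symm
      have h3 : μ - x k ≠ 0 := sub_ne_zero.2 (hμ k (Finset.mem_insert_of_mem hk))
      have hBB : B (x m) (B μ (Ψ (S.erase k))) = B μ (B (x m) (Ψ (S.erase k))) :=
        LinearMap.congr_fun (hB (x m) μ).eq _
      rw [Finset.erase_insert_of_ne (fun h : m = k => hm (h ▸ hk)), Finset.prod_insert hmk,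
        hΨ m _ hmk, hBB, smul_smul, smul_smul, ← add_smul]
      congr 1
      generalize ∏ j ∈ S.erase k, (1 - c / (x k - x j)) = p
      have : x k - x m = -(x m - x k) := by ring
      rw [this]
      field_simp
      ring
    rw [Finset.sum_insert hm, Finset.sum_congr rfl hsum, Finset.erase_insert hm,
      Finset.prod_insert hm, hΨ m S hm, hXB, ih μ fun k hk => hμ k (Finset.mem_insert_of_mem hk),
      ih (x m) hne]
    simp only [map_add, map_sum, map_smul, Finset.sum_add_distrib, ← Finset.smul_sum]
    module

variable {ι : Type*} {e : ι → Fin 2 → Fin 2 → Module.End ℂ V}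

lemma exchange_creation_commute {X : ℂ → Matrix (Fin 2) (Fin 2) (Module.End ℂ V)}
    (h : ∀ μ ν, Exchange (μ - ν) (X μ) (X ν)) (μ ν : ℂ) : Commute (X μ 0 1) (X ν 0 1) := by
  have h1 := h μ ν 0 1 0 1
  have h2 := h ν μ 0 1 0 1
  have h3 : (2 * Complex.I) • (X μ 0 1 * X ν 0 1) = (2 * Complex.I) • (X ν 0 1 * X μ 0 1) := by
    linear_combination (norm := module) (1 : ℂ) • h1 - (1 : ℂ) • h2
  exact smul_right_injective _ (by simp) h3

lemma exchange_A {X : ℂ → Matrix (Fin 2) (Fin 2) (Module.End ℂ V)}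
    (h : ∀ μ ν, Exchange (μ - ν) (X μ) (X ν)) {μ ν : ℂ} (hne : μ ≠ ν) :
    X μ 0 0 * X ν 0 1 = (1 - Complex.I / (μ - ν)) • (X ν 0 1 * X μ 0 0) +
      (Complex.I / (μ - ν)) • (X μ 0 1 * X ν 0 0) := by
  have h1 := h ν μ 0 1 0 0
  have h0 : μ - ν ≠ 0 := sub_ne_zero.2 hne
  refine smul_right_injective _ h0 ?_
  simp only [smul_add, smul_smul, mul_sub, mul_div_cancel₀ _ h0]
  linear_combination (norm := module) (1 : ℂ) • h1

lemma exchange_D {X : ℂ → Matrix (Fin 2) (Fin 2) (Module.End ℂ V)}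
    (h : ∀ μ ν, Exchange (μ - ν) (X μ) (X ν)) {μ ν : ℂ} (hne : μ ≠ ν) :
    X μ 1 1 * X ν 0 1 = (1 - -Complex.I / (μ - ν)) • (X ν 0 1 * X μ 1 1) +
      (-Complex.I / (μ - ν)) • (X μ 0 1 * X ν 1 1) := by
  have h1 := h μ ν 1 1 0 1
  have h0 : μ - ν ≠ 0 := sub_ne_zero.2 hne
  refine smul_right_injective _ h0 ?_
  simp only [smul_add, smul_smul, mul_sub, mul_div_cancel₀ _ h0]
  linear_combination (norm := module) (1 : ℂ) • h1

/-- A vector with all the spins up. -/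
structure IsVacuum (e : ι → Fin 2 → Fin 2 → Module.End ℂ V) (v : V) : Prop where
  up : ∀ k, e k 0 0 v = v
  down : ∀ k a, e k a 1 v = 0

lemma IsVacuum.monodromy_apply (he : IsSpinSystem e) {v : V} (hv : IsVacuum e v) (ν : ℂ) {n : ℕ}
    {f : Fin n → ι} (hf : Function.Injective f) :
    monodromy e ν f 0 0 v = (ν + Complex.I) ^ n • v ∧ monodromy e ν f 1 0 v = 0 ∧
      monodromy e ν f 1 1 v = ν ^ n • v := by
  induction n with
  | zero => simp [monodromy_zero]
  | succ n ih =>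
    obtain ⟨hA, hC, hD⟩ := ih (f := f ∘ Fin.castSucc) (hf.comp (Fin.castSucc_injective n))
    have hcomm : Commute (siteLax e (f (Fin.last n)) ν 1 0)
        (monodromy e ν (f ∘ Fin.castSucc) 0 1) :=
      he.commute_siteLax_monodromy (fun m h => (Fin.castSucc_lt_last m).ne (hf h).symm) _ _ _ _ _ _
    have hB : siteLax e (f (Fin.last n)) ν 1 0 (monodromy e ν (f ∘ Fin.castSucc) 0 1 v) = 0 := by
      have := LinearMap.congr_fun hcomm.eq v
      simp only [Module.End.mul_apply] at this
      rw [this]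
      simp [siteLax_apply, hv.down]
    simp only [monodromy_succ, Matrix.mul_apply, Fin.sum_univ_two, LinearMap.add_apply,
      Module.End.mul_apply, hA, hC, hD, hB, map_zero, map_smul, add_zero, zero_add]
    refine ⟨?_, ?_, ?_⟩
    · simp only [siteLax_apply, if_true, LinearMap.add_apply, LinearMap.smul_apply, hv.up,
        Module.End.one_apply]
      module
    · simp [siteLax_apply, hv.down]
    · simp only [siteLax_apply, if_true, LinearMap.add_apply, LinearMap.smul_apply, hv.down,
        Module.End.one_apply]
      module

end BetheAnsatz

section Eigenvector

variable {κ : Type*} [Fintype κ] [DecidableEq κ]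

lemma bethe_cancel {n : ℕ} {x : κ → ℂ} (hx : Function.Injective x) {k : κ} (h0 : x k ≠ 0)
    (hI : x k + Complex.I ≠ 0)
    (h : ((x k + Complex.I) / x k) ^ n =
      ∏ j ∈ Finset.univ.erase k, (x k - x j + Complex.I) / (x k - x j - Complex.I)) :
    (x k + Complex.I) ^ n * ∏ j ∈ Finset.univ.erase k, (1 - Complex.I / (x k - x j)) =
      x k ^ n * ∏ j ∈ Finset.univ.erase k, (1 - -Complex.I / (x k - x j)) := by
  have hne : ∀ j ∈ Finset.univ.erase k, x k - x j ≠ 0 := fun j hj =>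
    sub_ne_zero.2 fun h => Finset.ne_of_mem_erase hj (hx h).symm
  have h1 : ∀ j ∈ Finset.univ.erase k,
      1 - Complex.I / (x k - x j) = (x k - x j - Complex.I) / (x k - x j) := fun j hj => by
    rw [sub_div, div_self (hne j hj)]
  have h2 : ∀ j ∈ Finset.univ.erase k,
      1 - -Complex.I / (x k - x j) = (x k - x j + Complex.I) / (x k - x j) := fun j hj => by
    rw [add_div, div_self (hne j hj)]; ring
  rw [Finset.prod_congr rfl h1, Finset.prod_congr rfl h2]
  rw [Finset.prod_div_distrib, div_pow] at h
  have hd : ∏ j ∈ Finset.univ.erase k, (x k - x j - Complex.I) ≠ 0 := fun h' => by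
    rw [h', div_zero] at h
    exact div_ne_zero (pow_ne_zero n hI) (pow_ne_zero n h0) h
  rw [div_eq_div_iff (pow_ne_zero n h0) hd] at h
  rw [Finset.prod_div_distrib, Finset.prod_div_distrib, mul_div_assoc', mul_div_assoc', h, mul_comm]

/-- The eigenvalue of the transfer matrix on the Bethe vector with parameters `x`. -/
def transferEigenvalue (n : ℕ) (x : κ → ℂ) (ν : ℂ) : ℂ :=
  (ν + Complex.I) ^ n * ∏ j, (1 - Complex.I / (ν - x j)) +
    ν ^ n * ∏ j, (1 - -Complex.I / (ν - x j))

lemma hasDerivAt_one_sub_div {c y : ℂ} (hy : y ≠ 0) :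
    HasDerivAt (fun ν : ℂ => 1 - c / (ν - y)) (c / y ^ 2) 0 := by
  have h := (((hasDerivAt_id (0 : ℂ)).sub_const y).fun_inv (by simpa using hy)).const_mul c
  simpa [div_eq_mul_inv] using h.const_sub 1

lemma hasDerivAt_transferEigenvalue {n : ℕ} {x : κ → ℂ} (h0 : ∀ j, x j ≠ 0)
    (hI : ∀ j, x j + Complex.I ≠ 0) :
    HasDerivAt (transferEigenvalue (n + 2) x) (-Complex.I * transferEigenvalue (n + 2) x 0 *
      ((n + 2 : ℕ) - ∑ j, 1 / (x j * (x j + Complex.I)))) 0 := by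
  have hP (c : ℂ) := HasDerivAt.fun_finsetProd (u := Finset.univ)
    fun j (_ : j ∈ Finset.univ) => hasDerivAt_one_sub_div (c := c) (h0 j)
  have hA := (((hasDerivAt_id (0 : ℂ)).add_const Complex.I).fun_pow (n + 2)).fun_mul (hP Complex.I)
  have hD := ((hasDerivAt_id (0 : ℂ)).fun_pow (n + 2)).fun_mul (hP (-Complex.I))
  refine (hA.fun_add hD).congr_deriv ?_
  have hterm (j : κ) : (∏ i ∈ Finset.univ.erase j, (1 - Complex.I / (0 - x i))) *
      (Complex.I / x j ^ 2) = (∏ i, (1 - Complex.I / (0 - x i))) *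
        (Complex.I * (1 / (x j * (x j + Complex.I)))) := by
    have := h0 j
    have := hI j
    rw [← Finset.mul_prod_erase _ _ (Finset.mem_univ j)]
    generalize ∏ i ∈ Finset.univ.erase j, (1 - Complex.I / (0 - x i)) = p
    field_simp
    ring
  simp only [transferEigenvalue, id_eq, smul_eq_mul, hterm, ← Finset.mul_sum]
  generalize ∏ i, (1 - Complex.I / (0 - x i)) = P
  generalize ∑ j, 1 / (x j * (x j + Complex.I)) = s
  simp
  linear_combination ((n + 2) * Complex.I ^ (n + 1) * P) * Complex.I_mul_I

variable {V : Type*} [AddCommGroup V] [Module ℂ V] {ι : Type*}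
  {e : ι → Fin 2 → Fin 2 → Module.End ℂ V}

lemma IsSpinSystem.trace_monodromy_apply (he : IsSpinSystem e) {v : V} (hv : IsVacuum e v)
    {n : ℕ} {f : Fin n → ι} (hf : Function.Injective f) {x : κ → ℂ} (hx : Function.Injective x)
    (h0 : ∀ k, x k ≠ 0) (hI : ∀ k, x k + Complex.I ≠ 0)
    (hBAE : ∀ k, ((x k + Complex.I) / x k) ^ n =
      ∏ j ∈ Finset.univ.erase k, (x k - x j + Complex.I) / (x k - x j - Complex.I))
    {Ψ : Finset κ → V} (hΨ0 : Ψ ∅ = v)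
    (hΨ : ∀ m S, m ∉ S → Ψ (insert m S) = monodromy e (x m) f 0 1 (Ψ S))
    {ν : ℂ} (hν : ∀ k, ν ≠ x k) :
    (monodromy e ν f).trace (Ψ Finset.univ) = transferEigenvalue n x ν • Ψ Finset.univ := by
  have hex (μ ν : ℂ) := he.exchange_monodromy μ ν hf
  have hB := exchange_creation_commute hex
  have hA := offShell_action (fun μ ν h => exchange_A hex h) hB (a := fun ν => (ν + Complex.I) ^ n)
    hx (fun μ => hΨ0 ▸ (hv.monodromy_apply he μ hf).1) hΨ Finset.univ ν fun k _ => hν k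
  have hD := offShell_action (fun μ ν h => exchange_D hex h) hB (a := fun ν => ν ^ n)
    hx (fun μ => hΨ0 ▸ (hv.monodromy_apply he μ hf).2.2) hΨ Finset.univ ν fun k _ => hν k
  rw [Matrix.trace_fin_two, LinearMap.add_apply, hA, hD, add_add_add_comm, ← add_smul,
    ← Finset.sum_add_distrib, Finset.sum_eq_zero, add_zero, transferEigenvalue]
  intro k _
  rw [bethe_cancel hx (h0 k) (hI k) (hBAE k)]
  module

/-- The Bethe vector is an eigenvector of the sum of the permutations of neighbouring sites. -/
lemma IsSpinSystem.sum_sitePerm_apply (he : IsSpinSystem e) {v : V} (hv : IsVacuum e v)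
    {n : ℕ} {f : Fin (n + 2) → ι} (hf : Function.Injective f) {x : κ → ℂ}
    (hx : Function.Injective x) (h0 : ∀ k, x k ≠ 0) (hI : ∀ k, x k + Complex.I ≠ 0)
    (hBAE : ∀ k, ((x k + Complex.I) / x k) ^ (n + 2) =
      ∏ j ∈ Finset.univ.erase k, (x k - x j + Complex.I) / (x k - x j - Complex.I))
    {Ψ : Finset κ → V} (hΨ0 : Ψ ∅ = v)
    (hΨ : ∀ m S, m ∉ S → Ψ (insert m S) = monodromy e (x m) f 0 1 (Ψ S)) :
    (∑ k, sitePerm e (f k) (f (finRotate _ k))) (Ψ Finset.univ) =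
      ((n + 2 : ℕ) - ∑ j, 1 / (x j * (x j + Complex.I))) • Ψ Finset.univ := by
  have htr {ν : ℂ} (hν : ∀ k, ν ≠ x k) :=
    he.trace_monodromy_apply hv hf hx h0 hI hBAE hΨ0 hΨ hν
  have hderiv : (monodromyDeriv e f).trace (Ψ Finset.univ) =
      (-Complex.I * transferEigenvalue (n + 2) x 0 *
        ((n + 2 : ℕ) - ∑ j, 1 / (x j * (x j + Complex.I)))) • Ψ Finset.univ := by
    rw [← sub_eq_zero, ← Module.forall_dual_apply_eq_zero_iff ℂ]
    intro φ
    rw [map_sub, map_smul, sub_eq_zero, smul_eq_mul]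
    have h1 := hasDerivAt_monodromy (e := e) f
      (φ ∘ₗ LinearMap.applyₗ (Ψ Finset.univ) ∘ₗ Matrix.traceLinearMap (Fin 2) ℂ (Module.End ℂ V))
    have h2 := (hasDerivAt_transferEigenvalue (n := n) h0 hI).mul_const (φ (Ψ Finset.univ))
    refine (h1.congr_of_eventuallyEq ?_).unique h2
    have hev : ∀ᶠ ν in nhds (0 : ℂ), ∀ k, ν ≠ x k :=
      Filter.eventually_all.2 fun k => eventually_ne_nhds (h0 k).symm
    filter_upwards [hev] with ν hν
    simp [htr hν]
  have h00 : transferEigenvalue (n + 2) x 0 ≠ 0 := by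
    have h (j : κ) : 1 - Complex.I / (0 - x j) ≠ 0 := by
      have := h0 j
      have := hI j
      rw [zero_sub, div_neg, sub_neg_eq_add, one_add_div (h0 j)]
      exact div_ne_zero (hI j) (h0 j)
    simpa [transferEigenvalue] using Finset.prod_ne_zero_iff.2 fun j _ => h j
  have h := LinearMap.congr_fun (he.sum_sitePerm_mul_trace hf) (Ψ Finset.univ)
  rw [Module.End.mul_apply, htr fun k => (h0 k).symm, map_smul, LinearMap.smul_apply, hderiv,
    smul_smul] at h
  refine smul_right_injective _ h00 (h.trans ?_)
  simp only [smul_smul]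
  congr 1
  linear_combination (-transferEigenvalue (n + 2) x 0 *
        ((n + 2 : ℕ) - ∑ j, 1 / (x j * (x j + Complex.I)))) * Complex.I_mul_I

end Eigenvector

section Chain

/-- `IsSpinSystem.sum_sitePerm_apply` for an ordered product of creation operators. -/
lemma IsSpinSystem.sum_sitePerm_apply_prod {V : Type*} [AddCommGroup V] [Module ℂ V] {ι : Type*}
    {e : ι → Fin 2 → Fin 2 → Module.End ℂ V} (he : IsSpinSystem e) {v : V} (hv : IsVacuum e v)
    {n ℓ : ℕ} {f : Fin (n + 2) → ι} (hf : Function.Injective f) {x : Fin ℓ → ℂ}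
    (hx : Function.Injective x) (h0 : ∀ k, x k ≠ 0) (hI : ∀ k, x k + Complex.I ≠ 0)
    (hBAE : ∀ k, ((x k + Complex.I) / x k) ^ (n + 2) =
      ∏ j ∈ Finset.univ.erase k, (x k - x j + Complex.I) / (x k - x j - Complex.I)) :
    (∑ k, sitePerm e (f k) (f (finRotate _ k)))
        ((List.ofFn fun j => monodromy e (x j) f 0 1).prod v) =
      ((n + 2 : ℕ) - ∑ j, 1 / (x j * (x j + Complex.I))) •
        (List.ofFn fun j => monodromy e (x j) f 0 1).prod v := by
  have hB := exchange_creation_commute fun μ ν => he.exchange_monodromy μ ν hf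
  have hcomm (S : Finset (Fin ℓ)) :
      (S : Set (Fin ℓ)).Pairwise (Function.onFun Commute fun j => monodromy e (x j) f 0 1) :=
    fun i _ j _ _ => hB (x i) (x j)
  have huniv : Finset.univ.noncommProd (fun j => monodromy e (x j) f 0 1) (hcomm _) =
      (List.ofFn fun j => monodromy e (x j) f 0 1).prod := by
    rw [List.ofFn_eq_map, ← Finset.noncommProd_toFinset _ _ _ (List.nodup_finRange ℓ)]
    · congr 1
      simp
    · exact fun i _ j _ _ => hB (x i) (x j)
  rw [← huniv]
  refine he.sum_sitePerm_apply hv hf hx h0 hI hBAE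
    (Ψ := fun S => S.noncommProd (fun j => monodromy e (x j) f 0 1) (hcomm S) v) (by simp) ?_
  intro m S hm
  simp [Finset.noncommProd_insert_of_notMem _ _ _ _ hm]

lemma pauli_lax_eq {R : Type*} [Ring R] [Algebra ℂ R] {u : Fin 2 → Fin 2 → R}
    (hu : u 0 0 + u 1 1 = 1) (lam : ℂ) {s : Matrix (Fin 2) (Fin 2) ℂ → R}
    (hs : ∀ M, s M = M 0 0 • u 0 0 + M 0 1 • u 0 1 + M 1 0 • u 1 0 + M 1 1 • u 1 1) :
    !![lam • (1 : R) + (Complex.I / 2) • s pauliZ, (Complex.I / 2) • s pauliMinus;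
      (Complex.I / 2) • s pauliPlus, lam • (1 : R) - (Complex.I / 2) • s pauliZ] =
    Matrix.of (fun a b => Complex.I • u b a) + (lam - Complex.I / 2) • 1 := by
  ext1 i j
  fin_cases i <;> fin_cases j <;>
    simp [hs, pauliZ, pauliPlus, pauliMinus, pauliX, pauliY] <;>
    (try rw [← hu]) <;> module

lemma pauli_exchange_eq {R : Type*} [Ring R] [Algebra ℂ R] {ι : Type*}
    {e : ι → Fin 2 → Fin 2 → R} (he : ∀ k, e k 0 0 + e k 1 1 = 1)
    {s : ι → Matrix (Fin 2) (Fin 2) ℂ → R}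
    (hs : ∀ k M, s k M = M 0 0 • e k 0 0 + M 0 1 • e k 0 1 + M 1 0 • e k 1 0 + M 1 1 • e k 1 1)
    (k l : ι) :
    s k pauliX * s l pauliX + s k pauliY * s l pauliY + s k pauliZ * s l pauliZ - 1 =
      (2 : ℂ) • (sitePerm e k l - 1) := by
  have h1 : (1 : R) = (e k 0 0 + e k 1 1) * (e l 0 0 + e l 1 1) := by simp [he]
  have hX (k : ι) : s k pauliX = e k 0 1 + e k 1 0 := by
    simp [hs, pauliX]
  have hY (k : ι) : s k pauliY = Complex.I • (e k 1 0 - e k 0 1) := by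
    simp [hs, pauliY]
    module
  have hZ (k : ι) : s k pauliZ = e k 0 0 - e k 1 1 := by
    simp [hs, pauliZ]
    module
  rw [h1]
  simp only [hX, hY, hZ, smul_mul_smul_comm, Complex.I_mul_I, neg_one_smul, two_smul, sitePerm,
    Fin.sum_univ_two]
  noncomm_ring

/-- The Hamiltonian is `(J/2) ∑ (P - 1)` in terms of the permutations of neighbouring sites. -/
lemma heisenberg_apply_of_sum_sitePerm {V : Type*} [AddCommGroup V] [Module ℂ V] {N : ℕ}
    {e : Fin N → Fin 2 → Fin 2 → Module.End ℂ V} (he : ∀ k, e k 0 0 + e k 1 1 = 1)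
    {s : Fin N → Matrix (Fin 2) (Fin 2) ℂ → Module.End ℂ V}
    (hs : ∀ k M, s k M = M 0 0 • e k 0 0 + M 0 1 • e k 0 1 + M 1 0 • e k 1 0 + M 1 1 • e k 1 1)
    {σ : Equiv.Perm (Fin N)} {w : V} {E : ℂ}
    (hw : (∑ k, sitePerm e k (σ k)) w = (N - E) • w) (J : ℝ) :
    (((J : ℂ) / 4) • ∑ k : Fin N, (s k pauliX * s (σ k) pauliX + s k pauliY * s (σ k) pauliY +
      s k pauliZ * s (σ k) pauliZ - 1)) w = (-((J : ℂ) / 2) * E) • w := by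
  simp only [pauli_exchange_eq he hs, ← Finset.smul_sum, Finset.sum_sub_distrib,
    LinearMap.smul_apply, LinearMap.sub_apply, hw]
  simp only [Finset.sum_const, Finset.card_univ, Fintype.card_fin, LinearMap.smul_apply,
    Module.End.one_apply, ← Nat.cast_smul_eq_nsmul ℂ]
  module

variable {N : ℕ}

lemma isSpinSystem_unitOp : IsSpinSystem (unitOp (N := N)) where
  mul := unitOp_mul
  commute _ _ := unitOp_commute
  add_eq_one := unitOp_add_eq_one

lemma isVacuum_vacuum : IsVacuum (unitOp (N := N)) (vacuum N) where
  up k := by simpa using unitOp_vacuum k 0 0 (.inr rfl)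
  down k a := by simpa using unitOp_vacuum k a 1 (.inl rfl)

lemma lax_eq_siteLax (k : Fin N) (lam : ℂ) :
    lax N k lam = siteLax unitOp k (lam - Complex.I / 2) :=
  pauli_lax_eq (R := Module.End ℂ (QState N)) (u := unitOp k) (s := siteOp N k)
    (unitOp_add_eq_one k) lam (siteOp_eq_unitOp k)

lemma Bop_eq_monodromy (lam : ℂ) :
    Bop N lam = monodromy unitOp (lam - Complex.I / 2) id 0 1 := by
  simp only [Bop, transfer, lax_eq_siteLax]
  rfl

end Chain

/-- Bethe vectors for solutions of the Bethe ansatz equations with pairwise distinct,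
non-singular roots are eigenvectors of the Heisenberg Hamiltonian with eigenvalue
`−(J/2)·∑_j 1/(λ_j² + 1/4)`. -/
theorem ham_betheVec (N : ℕ) (hN : 2 ≤ N) (J : ℝ) {ℓ : ℕ} (lam : Fin ℓ → ℂ)
    (hdist : Function.Injective lam)
    (hreg : ∀ j, lam j ≠ Complex.I / 2 ∧ lam j ≠ -(Complex.I / 2))
    (hBAE : ∀ k, ((lam k + Complex.I / 2) / (lam k - Complex.I / 2)) ^ N =
      ∏ j ∈ Finset.univ.erase k,
        (lam k - lam j + Complex.I) / (lam k - lam j - Complex.I)) :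
    ham N J (betheVec N lam) =
      (-((J : ℂ) / 2) * ∑ j, 1 / (lam j ^ 2 + 1 / 4)) • betheVec N lam := by
  obtain ⟨n, rfl⟩ := Nat.exists_eq_add_of_le' hN
  have hbv : betheVec (n + 2) lam = (List.ofFn fun j => monodromy unitOp (lam j - Complex.I / 2)
      (id : Fin (n + 2) → Fin (n + 2)) 0 1).prod (vacuum (n + 2)) := by
    simp only [betheVec, Bop_eq_monodromy]
  have h := isSpinSystem_unitOp.sum_sitePerm_apply_prod (isVacuum_vacuum (N := n + 2))
    Function.injective_id (x := fun j => lam j - Complex.I / 2)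
    (fun i j h => hdist (sub_left_injective h)) (fun k => sub_ne_zero.2 (hreg k).1)
    (fun k h => (hreg k).2 (by linear_combination h))
    (fun k => by
      convert hBAE k using 2
      · ring
      · simp)
  rw [← hbv] at h
  have hE (j : Fin ℓ) : (lam j - Complex.I / 2) * (lam j - Complex.I / 2 + Complex.I) =
      lam j ^ 2 + 1 / 4 := by
    linear_combination (-(1 : ℂ) / 4) * Complex.I_mul_I
  simp only [hE] at h
  exact heisenberg_apply_of_sum_sitePerm unitOp_add_eq_one siteOp_eq_unitOp h J

end Heisenberg
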